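/- arXiv:1101.4708 — 2 statements merged into one kernel-verified Lean document; each statement's English description precedes it below -/
import Mathlib

section
/- If m: Σ → L(X,Y) is a (countable) purely atomic operator-valued measure, then m satisfies Condition (GB). -/
open MeasureTheory Filter Topology Set ENNReal

variable {𝕜 : Type*} [RCLike 𝕜]
variable {T : Type*} [MeasurableSpace T]
variable {X : Type*} [AddCommGroup X] [Module 𝕜 X] [TopologicalSpace X]
variable {Y : Type*} [AddCommGroup Y] [Module 𝕜 Y] [TopologicalSpace Y]

/-- An operator-valued measure: `m ∅ = 0` and for each `x : X`, the map `E ↦ m E x`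
is a countably additive `Y`-valued vector measure. -/
def IsOVMeasure (m : Set T → X →L[𝕜] Y) : Prop :=
  m ∅ = 0 ∧ ∀ (x : X) (E : ℕ → Set T), (∀ n, MeasurableSet (E n)) →
    Pairwise (Function.onFun Disjoint E) →
      HasSum (fun n => m (E n) x) (m (⋃ n, E n) x)

/-- The `(p,q)`-semivariation of `m`. -/
noncomputable def semivar (m : Set T → X →L[𝕜] Y) (p : Seminorm 𝕜 X) (q : Seminorm 𝕜 Y)
    (E : Set T) : ℝ≥0∞ :=
  ⨆ (N : ℕ) (En : Fin N → Set T) (_ : ∀ n, MeasurableSet (En n))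
    (_ : Pairwise (Function.onFun Disjoint En)) (_ : E ⊆ ⋃ n, En n)
    (x : Fin N → X) (_ : ∀ n, p (x n) ≤ 1),
      ENNReal.ofReal (q (∑ n, m (En n ∩ E) (x n)))

/-- `q_p(L) = sup { q (L x) : p x ≤ 1 }`. -/
noncomputable def opSemi (p : Seminorm 𝕜 X) (q : Seminorm 𝕜 Y) (L : X →L[𝕜] Y) : ℝ≥0∞ :=
  ⨆ (x : X) (_ : p x ≤ 1), ENNReal.ofReal (q (L x))

/-- The `(p,q)`-variation of `m`. -/
noncomputable def varPQ (m : Set T → X →L[𝕜] Y) (p : Seminorm 𝕜 X) (q : Seminorm 𝕜 Y)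
    (E : Set T) : ℝ≥0∞ :=
  ⨆ (N : ℕ) (En : Fin N → Set T) (_ : ∀ n, MeasurableSet (En n))
    (_ : Pairwise (Function.onFun Disjoint En)) (_ : E = ⋃ n, En n),
      ∑ n, opSemi p q (m (En n ∩ E))

/-- The inner `(p,q)`-semivariation of `m`. -/
noncomputable def innerSemivar (m : Set T → X →L[𝕜] Y) (p : Seminorm 𝕜 X) (q : Seminorm 𝕜 Y)
    (G : Set T) : ℝ≥0∞ :=
  ⨆ (F : Set T) (_ : MeasurableSet F) (_ : F ⊆ G), semivar m p q F

/-- `E` is of finite variation of `m`: for every `q ∈ Q` there is `p ∈ P` with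
`var_{p,q}(m,E) < ∞` (the relation `q ↦_E p`). -/
def FiniteVar (P : Set (Seminorm 𝕜 X)) (Q : Set (Seminorm 𝕜 Y)) (m : Set T → X →L[𝕜] Y)
    (E : Set T) : Prop :=
  ∀ q ∈ Q, ∃ p ∈ P, varPQ m p q E < ⊤

/-- `E` is of positive variation of `m`. -/
def PositiveVar (P : Set (Seminorm 𝕜 X)) (Q : Set (Seminorm 𝕜 Y)) (m : Set T → X →L[𝕜] Y)
    (E : Set T) : Prop :=
  ∃ p ∈ P, ∃ q ∈ Q, 0 < varPQ m p q E

/-- Condition (GB). -/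
def ConditionGB (P : Set (Seminorm 𝕜 X)) (Q : Set (Seminorm 𝕜 Y))
    (m : Set T → X →L[𝕜] Y) : Prop :=
  ∀ E : Set T, MeasurableSet E → FiniteVar P Q m E → PositiveVar P Q m E →
    ∀ (ι : Type*) [Preorder ι] [IsDirected ι (· ≤ ·)] [Nonempty ι],
      ∀ Ei : ι → Set T, (∀ i, MeasurableSet (Ei i)) → (∀ i, Ei i ⊆ E) →
        (∃ δ : Seminorm 𝕜 X → Seminorm 𝕜 Y → ℝ,
          ∀ p ∈ P, ∀ q ∈ Q, varPQ m p q E < ⊤ →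
            0 < δ p q ∧ ∀ i, ENNReal.ofReal (δ p q) ≤ semivar m p q (Ei i)) →
        (⋂ i, ⋃ j, ⋃ _ : i ≤ j, Ei j).Nonempty

/-- An `m̂`-atom: a measurable set of positive semivariation whose nonempty proper
subsets are all nonmeasurable. -/
def IsMAtom (P : Set (Seminorm 𝕜 X)) (Q : Set (Seminorm 𝕜 Y)) (m : Set T → X →L[𝕜] Y)
    (A : Set T) : Prop :=
  MeasurableSet A ∧ (∃ p ∈ P, ∃ q ∈ Q, 0 < semivar m p q A) ∧
    ∀ B : Set T, B ⊂ A → B.Nonempty → ¬ MeasurableSet B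

/-- `m` is (countably) purely atomic: every measurable set is a countable union of
`m̂`-atoms. -/
def IsAtomicMeasure (P : Set (Seminorm 𝕜 X)) (Q : Set (Seminorm 𝕜 Y)) (m : Set T → X →L[𝕜] Y) :
    Prop :=
  ∀ E : Set T, MeasurableSet E →
    ∃ 𝒜 : Set (Set T), 𝒜.Countable ∧ (∀ A ∈ 𝒜, IsMAtom P Q m A) ∧ E = ⋃₀ 𝒜

/-- The semivariation of `m` is generalized strongly continuous (GS-continuous). -/
def GSContinuous (P : Set (Seminorm 𝕜 X)) (Q : Set (Seminorm 𝕜 Y))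
    (m : Set T → X →L[𝕜] Y) : Prop :=
  ∀ E : Set T, MeasurableSet E → FiniteVar P Q m E →
    ∀ (ι : Type*) [Preorder ι] [IsDirected ι (· ≤ ·)] [Nonempty ι],
      ∀ Ei : ι → Set T, (∀ i, Ei i ⊆ E) →
        ∀ p ∈ P, ∀ q ∈ Q, varPQ m p q E < ⊤ →
          (Monotone Ei → Tendsto (fun i => innerSemivar m p q (Ei i)) atTop
              (𝓝 (innerSemivar m p q (⋃ i, Ei i)))) ∧
          (Antitone Ei → Tendsto (fun i => innerSemivar m p q (Ei i)) atTop
              (𝓝 (innerSemivar m p q (⋂ i, Ei i))))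

/-- A function `f : T → X` is measurable if `{t : p (f t) ≥ η} ∈ Σ` for all `η > 0`, `p ∈ P`. -/
def MeasFun (P : Set (Seminorm 𝕜 X)) (f : T → X) : Prop :=
  ∀ η : ℝ, 0 < η → ∀ p ∈ P, MeasurableSet {t | η ≤ p (f t)}

/-- A measurable set which is a countable union of sets without proper nonempty measurable
subsets is the union of a disjoint sequence of measurable sets with the same property. -/
theorem exists_disjoint_minimal_seq {E : Set T} {𝒜 : Set (Set T)} (hc : 𝒜.Countable)
    (hmeas : ∀ A ∈ 𝒜, MeasurableSet A)
    (hmin : ∀ A ∈ 𝒜, ∀ B : Set T, B ⊂ A → B.Nonempty → ¬ MeasurableSet B) (hE : E = ⋃₀ 𝒜) :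
    ∃ B : ℕ → Set T, (∀ k, MeasurableSet (B k)) ∧ Pairwise (Function.onFun Disjoint B) ∧
      (∀ k C, MeasurableSet C → C ⊆ B k → C.Nonempty → C = B k) ∧ E = ⋃ k, B k := by
  obtain ⟨A, hA⟩ := (hc.insert ∅).exists_eq_range (insert_nonempty _ _)
  have hmem : ∀ k, A k = ∅ ∨ A k ∈ 𝒜 := fun k => by
    have : A k ∈ insert ∅ 𝒜 := hA ▸ mem_range_self k
    simpa using this
  have hAm : ∀ k, MeasurableSet (A k) := fun k =>
    (hmem k).elim (fun h => h ▸ MeasurableSet.empty) (hmeas _)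
  refine ⟨disjointed A, MeasurableSet.disjointed hAm, disjoint_disjointed A, ?_, ?_⟩
  · intro k C hC hCB hne
    have hCA : C ⊆ A k := hCB.trans (disjointed_subset A k)
    rcases hmem k with h | h
    · simp [h, hne.ne_empty] at hCA
    · have hCeq : C = A k := by
        by_contra hn
        exact hmin _ h C (hCA.ssubset_of_ne hn) hne hC
      exact hCB.antisymm (hCeq ▸ disjointed_subset A k)
  · rw [iUnion_disjointed, ← sUnion_range, ← hA, sUnion_insert, empty_union, hE]

/-- The semivariation of a measurable set covered by a disjoint sequence of sets without proper
nonempty measurable subsets is at most the sum of the operator seminorms of `m` on them. -/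
theorem semivar_le_tsum_opSemi {m : Set T → X →L[𝕜] Y} (hm : IsOVMeasure m) (p : Seminorm 𝕜 X)
    {q : Seminorm 𝕜 Y} (hq : Continuous q) [ContinuousAdd Y] {B : ℕ → Set T}
    (hB : ∀ k, MeasurableSet (B k)) (hd : Pairwise (Function.onFun Disjoint B))
    (hmin : ∀ k C, MeasurableSet C → C ⊆ B k → C.Nonempty → C = B k) {F : Set T}
    (hF : MeasurableSet F) (hFB : F ⊆ ⋃ k, B k) :
    semivar m p q F ≤ ∑' k, opSemi p q (m (B k)) := by
  unfold semivar
  simp only [iSup_le_iff]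
  intro N En hEn hdis _ x hx
  have hsum : HasSum (fun k => ∑ n, m (B k ∩ (En n ∩ F)) (x n)) (∑ n, m (En n ∩ F) (x n)) := by
    refine hasSum_sum fun n _ => ?_
    have h := hm.2 (x n) (fun k => B k ∩ (En n ∩ F)) (fun k => (hB k).inter ((hEn n).inter hF))
      (fun i j hij => (hd hij).mono inter_subset_left inter_subset_left)
    rwa [← iUnion_inter, inter_eq_right.2 (inter_subset_right.trans hFB)] at h
  have hterm : ∀ k, ENNReal.ofReal (q (∑ n, m (B k ∩ (En n ∩ F)) (x n))) ≤
      opSemi p q (m (B k)) := by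
    intro k
    by_cases hex : ∃ n, (B k ∩ (En n ∩ F)).Nonempty
    · obtain ⟨n, hn⟩ := hex
      have heq := hmin k _ ((hB k).inter ((hEn n).inter hF)) inter_subset_left hn
      rw [Finset.sum_eq_single n, heq]
      · exact le_iSup₂_of_le (x n) (hx n) le_rfl
      · intro l _ hl
        have hempty : B k ∩ (En l ∩ F) = ∅ := by
          have hsub : B k ⊆ En n := fun t ht => (heq.ge ht).2.1
          exact ((hdis hl.symm).mono hsub inter_subset_left).inter_eq
        simp [hempty, hm.1]
      · simp
    · have hempty : ∀ n, B k ∩ (En n ∩ F) = ∅ := fun n =>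
        not_nonempty_iff_eq_empty.1 fun h => hex ⟨n, h⟩
      simp [hempty, hm.1]
  refine le_of_tendsto ((ENNReal.continuous_ofReal.comp hq).tendsto _ |>.comp hsum)
    (Eventually.of_forall fun s => ?_)
  calc ENNReal.ofReal (q (∑ k ∈ s, ∑ n, m (B k ∩ (En n ∩ F)) (x n)))
      ≤ ENNReal.ofReal (∑ k ∈ s, q (∑ n, m (B k ∩ (En n ∩ F)) (x n))) :=
        ENNReal.ofReal_le_ofReal (Finset.le_sum_of_subadditive q (map_zero q).le (map_add_le_add q) s _)
    _ = ∑ k ∈ s, ENNReal.ofReal (q (∑ n, m (B k ∩ (En n ∩ F)) (x n))) :=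
        ENNReal.ofReal_sum_of_nonneg fun _ _ => apply_nonneg _ _
    _ ≤ ∑ k ∈ s, opSemi p q (m (B k)) := Finset.sum_le_sum fun k _ => hterm k
    _ ≤ ∑' k, opSemi p q (m (B k)) := ENNReal.sum_le_tsum s

/-- The operator seminorms of `m` along a disjoint measurable sequence sum to at most the
variation of `m` on the union. -/
theorem tsum_opSemi_le_varPQ (m : Set T → X →L[𝕜] Y) (p : Seminorm 𝕜 X) (q : Seminorm 𝕜 Y)
    {B : ℕ → Set T} (hB : ∀ k, MeasurableSet (B k)) (hd : Pairwise (Function.onFun Disjoint B)) :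
    ∑' k, opSemi p q (m (B k)) ≤ varPQ m p q (⋃ k, B k) := by
  rw [ENNReal.tsum_eq_iSup_nat]
  refine iSup_le fun N => ?_
  set R : Set T := ⋃ k ≥ N, B k with hR
  have hRm : MeasurableSet R := .iUnion fun k => .iUnion fun _ => hB k
  have hdR : ∀ i : Fin N, Disjoint R (B i) := fun i => by
    simp only [hR, disjoint_iUnion_left]
    exact fun k hk => hd (by have := i.2; omega)
  let G : Fin (N + 1) → Set T := Fin.cons R fun i : Fin N => B i
  have hG : ⋃ k, B k = ⋃ n, G n := by
    ext t
    simp only [mem_iUnion, Fin.exists_fin_succ, G, Fin.cons_zero, Fin.cons_succ, hR]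
    constructor
    · rintro ⟨k, hk⟩
      rcases le_or_gt N k with h | h
      · exact Or.inl ⟨k, h, hk⟩
      · exact Or.inr ⟨⟨k, h⟩, hk⟩
    · rintro (⟨k, _, hk⟩ | ⟨k, hk⟩)
      exacts [⟨k, hk⟩, ⟨k, hk⟩]
  have hGd : Pairwise (Function.onFun Disjoint G) := by
    intro i j hij
    induction i using Fin.cases with
    | zero =>
      induction j using Fin.cases with
      | zero => exact absurd rfl hij
      | succ j => exact hdR j
    | succ i =>
      induction j using Fin.cases with
      | zero => exact (hdR i).symm
      | succ j => exact hd fun h => hij (congrArg Fin.succ (Fin.ext h))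
  have hGm : ∀ n, MeasurableSet (G n) := Fin.cases hRm fun i => hB i
  calc ∑ k ∈ Finset.range N, opSemi p q (m (B k))
      = ∑ i : Fin N, opSemi p q (m (B i)) := Finset.sum_range _
    _ ≤ ∑ n, opSemi p q (m (G n)) := by
        rw [Fin.sum_univ_succ]
        exact le_add_self
    _ = ∑ n, opSemi p q (m (G n ∩ ⋃ k, B k)) :=
        Finset.sum_congr rfl fun n _ => by
          rw [inter_eq_left.2 (hG ▸ subset_iUnion G n)]
    _ ≤ varPQ m p q (⋃ k, B k) :=
        le_iSup_of_le (N + 1) <| le_iSup_of_le G <| le_iSup_of_le hGm <| le_iSup_of_le hGd <|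
          le_iSup_of_le hG le_rfl

variable [T2Space X] [T2Space Y]

theorem atomic_implies_conditionGB
    (P : Set (Seminorm 𝕜 X)) (Q : Set (Seminorm 𝕜 Y)) [Nonempty P] [Nonempty Q]
    (hP : WithSeminorms (fun p : P => (p : Seminorm 𝕜 X)))
    (hQ : WithSeminorms (fun q : Q => (q : Seminorm 𝕜 Y)))
    (m : Set T → X →L[𝕜] Y) (hm : IsOVMeasure m)
    (hatomic : IsAtomicMeasure P Q m) :
    ConditionGB P Q m := by
  rintro E hE hfin - ι _ _ _ Ei hEi hsub ⟨δ, hδ⟩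
  obtain ⟨𝒜, hc, hatom, hE𝒜⟩ := hatomic E hE
  obtain ⟨B, hB, hd, hmin, hEB⟩ := exists_disjoint_minimal_seq hc (fun A hA => (hatom A hA).1)
    (fun A hA => (hatom A hA).2.2) hE𝒜
  obtain ⟨q, hqQ⟩ := ‹Nonempty Q›
  obtain ⟨p, hpP, hvar⟩ := hfin q hqQ
  obtain ⟨hδpos, hδle⟩ := hδ p hpP q hqQ hvar
  have := hQ.topologicalAddGroup
  have hq : Continuous q := hQ.continuous_seminorm ⟨q, hqQ⟩
  by_contra hempty
  have hev : ∀ k, ∀ᶠ j in atTop, Disjoint (Ei j) (B k) := by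
    intro k
    rcases (B k).eq_empty_or_nonempty with h | ⟨t, ht⟩
    · simp [h]
    · have htn : t ∉ ⋂ i, ⋃ j, ⋃ _ : i ≤ j, Ei j := fun h => hempty ⟨t, h⟩
      simp only [mem_iInter, mem_iUnion, exists_prop, not_forall, not_exists, not_and] at htn
      obtain ⟨i, hi⟩ := htn
      filter_upwards [eventually_ge_atTop i] with j hj
      rw [disjoint_iff_inter_eq_empty]
      by_contra hne
      have h := hmin k _ ((hEi j).inter (hB k)) inter_subset_right (nonempty_iff_ne_empty.2 hne)
      exact hi j hj (h.ge ht).1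
  have hsum : ∑' k, opSemi p q (m (B k)) ≠ ⊤ :=
    ((tsum_opSemi_le_varPQ m p q hB hd).trans_lt (hEB ▸ hvar)).ne
  obtain ⟨n, hn⟩ := ((ENNReal.tendsto_sum_nat_add _ hsum).eventually_lt_const
    (ENNReal.ofReal_pos.2 hδpos)).exists
  obtain ⟨j, hj⟩ := ((Finset.range n).eventually_all.2 fun k _ => hev k).exists
  have hcover : Ei j ⊆ ⋃ k, B (k + n) := by
    intro t ht
    obtain ⟨k, hk⟩ := mem_iUnion.1 (hEB ▸ hsub j ht)
    have hnk : n ≤ k := by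
      by_contra hlt
      exact (hj k (Finset.mem_range.2 (not_le.1 hlt))).notMem_of_mem_left ht hk
    exact mem_iUnion.2 ⟨k - n, by rwa [Nat.sub_add_cancel hnk]⟩
  exact (((hδle j).trans (semivar_le_tsum_opSemi hm p hq (fun k => hB (k + n))
    (fun a b hab => hd fun h => hab (Nat.add_right_cancel h)) (fun k => hmin (k + n)) (hEi j)
    hcover)).trans_lt hn).false
end

section
/- Let m: Σ → L(X,Y) be a (countable) purely atomic operator-valued measure and let 𝒜 denote the (at most countable) family of all m̂-atoms. For an arbitrary subset G ⊆ T, the set F* = ⋃{A ∈ 𝒜 : A ⊆ G} belongs to Σ and m̂*_{p,q}(G) = m̂_{p,q}(F*) for every p ∈ P and q ∈ Q; that is, the supremum defining the inner semivariation of G is attained at F*. -/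
open MeasureTheory Filter Topology Set ENNReal

variable {𝕜 : Type*} [RCLike 𝕜]
variable {T : Type*} [MeasurableSpace T]
variable {X : Type*} [AddCommGroup X] [Module 𝕜 X] [TopologicalSpace X]
variable {Y : Type*} [AddCommGroup Y] [Module 𝕜 Y] [TopologicalSpace Y]

theorem IsOVMeasure.semivar_empty {m : Set T → X →L[𝕜] Y} (hm : IsOVMeasure m)
    (p : Seminorm 𝕜 X) (q : Seminorm 𝕜 Y) : semivar m p q ∅ = 0 := by
  simp [semivar, hm.1]

theorem semivar_mono {m : Set T → X →L[𝕜] Y}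
    (p : Seminorm 𝕜 X) (q : Seminorm 𝕜 Y) {E F : Set T} (hE : MeasurableSet E)
    (hF : MeasurableSet F) (hEF : E ⊆ F) : semivar m p q E ≤ semivar m p q F := by
  rw [semivar]
  refine iSup_le fun N => iSup_le fun En => iSup_le fun hEn => iSup_le fun hd =>
    iSup_le fun hc => iSup_le fun x => iSup_le fun hx => ?_
  let En' : Fin (N + 1) → Set T := Fin.cons (F \ E) (fun n => En n ∩ E)
  let x' : Fin (N + 1) → X := Fin.cons 0 x
  have hmeas : ∀ n, MeasurableSet (En' n) :=
    Fin.cases (hF.diff hE) fun n => (hEn n).inter hE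
  have hdisj : Pairwise (Function.onFun Disjoint En') := by
    have h0 : ∀ n, Disjoint (F \ E) (En n ∩ E) := fun n =>
      disjoint_sdiff_left.mono_right inter_subset_right
    intro i j hij
    induction i using Fin.cases with
    | zero =>
      induction j using Fin.cases with
      | zero => exact absurd rfl hij
      | succ j => exact h0 j
    | succ i =>
      induction j using Fin.cases with
      | zero => exact (h0 i).symm
      | succ j =>
        exact (hd fun h => hij (congrArg Fin.succ h)).mono inter_subset_left inter_subset_left
  have hcover : F ⊆ ⋃ n, En' n := by
    intro t ht
    rw [mem_iUnion]
    by_cases hte : t ∈ E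
    · obtain ⟨n, hn⟩ := mem_iUnion.1 (hc hte)
      exact ⟨n.succ, hn, hte⟩
    · exact ⟨0, ht, hte⟩
  have hx' : ∀ n, p (x' n) ≤ 1 := Fin.cases (by simp [x']) hx
  have hsum : ∑ n, m (En' n ∩ F) (x' n) = ∑ n, m (En n ∩ E) (x n) := by
    simp [Fin.sum_univ_succ, En', x', inter_assoc, inter_eq_left.2 hEF]
  rw [← hsum, semivar]
  exact le_iSup_of_le (N + 1) <| le_iSup_of_le En' <| le_iSup_of_le hmeas <|
    le_iSup_of_le hdisj <| le_iSup_of_le hcover <| le_iSup_of_le x' <| le_iSup_of_le hx' le_rfl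

theorem IsMAtom.nonempty {P : Set (Seminorm 𝕜 X)} {Q : Set (Seminorm 𝕜 Y)}
    {m : Set T → X →L[𝕜] Y} (hm : IsOVMeasure m) {A : Set T} (hA : IsMAtom P Q m A) :
    A.Nonempty := by
  obtain ⟨-, ⟨p, -, q, -, hpq⟩, -⟩ := hA
  rw [nonempty_iff_ne_empty]
  rintro rfl
  exact hpq.ne' (hm.semivar_empty p q)

theorem IsMAtom.subset_of_inter_nonempty {P : Set (Seminorm 𝕜 X)} {Q : Set (Seminorm 𝕜 Y)}
    {m : Set T → X →L[𝕜] Y} {A B : Set T} (hA : IsMAtom P Q m A) (hB : MeasurableSet B)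
    (h : (A ∩ B).Nonempty) : A ⊆ B := by
  by_contra hAB
  exact hA.2.2 (A ∩ B) (inter_ssubset_left_iff.2 hAB) h (hA.1.inter hB)

theorem IsMAtom.eq_of_inter_nonempty {P : Set (Seminorm 𝕜 X)} {Q : Set (Seminorm 𝕜 Y)}
    {m : Set T → X →L[𝕜] Y} {A B : Set T} (hA : IsMAtom P Q m A) (hB : IsMAtom P Q m B)
    (h : (A ∩ B).Nonempty) : A = B :=
  (hA.subset_of_inter_nonempty hB.1 h).antisymm
    (hB.subset_of_inter_nonempty hA.1 (inter_comm A B ▸ h))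

theorem IsAtomicMeasure.countable_atoms {P : Set (Seminorm 𝕜 X)} {Q : Set (Seminorm 𝕜 Y)}
    {m : Set T → X →L[𝕜] Y} (hatomic : IsAtomicMeasure P Q m) (hm : IsOVMeasure m) :
    {A : Set T | IsMAtom P Q m A}.Countable := by
  obtain ⟨𝒜, hcount, hatoms, huniv⟩ := hatomic univ MeasurableSet.univ
  refine hcount.mono fun A hA => ?_
  obtain ⟨t, ht⟩ := IsMAtom.nonempty hm hA
  obtain ⟨B, hB, htB⟩ : t ∈ ⋃₀ 𝒜 := huniv ▸ mem_univ t
  exact IsMAtom.eq_of_inter_nonempty hA (hatoms B hB) ⟨t, ht, htB⟩ ▸ hB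

variable [T2Space X] [T2Space Y]

theorem atomic_innerSemivar_attained
    (P : Set (Seminorm 𝕜 X)) (Q : Set (Seminorm 𝕜 Y)) [Nonempty P] [Nonempty Q]
    (hP : WithSeminorms (fun p : P => (p : Seminorm 𝕜 X)))
    (hQ : WithSeminorms (fun q : Q => (q : Seminorm 𝕜 Y)))
    (m : Set T → X →L[𝕜] Y) (hm : IsOVMeasure m)
    (hatomic : IsAtomicMeasure P Q m)
    (G : Set T) :
    {A : Set T | IsMAtom P Q m A}.Countable ∧
    MeasurableSet (⋃₀ {A | IsMAtom P Q m A ∧ A ⊆ G}) ∧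
    ∀ p ∈ P, ∀ q ∈ Q,
      innerSemivar m p q G = semivar m p q (⋃₀ {A | IsMAtom P Q m A ∧ A ⊆ G}) := by
  have hcount := hatomic.countable_atoms hm
  have hmeas : MeasurableSet (⋃₀ {A | IsMAtom P Q m A ∧ A ⊆ G}) :=
    .sUnion (hcount.mono fun _ hA => hA.1) fun _ hA => hA.1.1
  refine ⟨hcount, hmeas, fun p _ q _ => le_antisymm ?_ ?_⟩
  · refine iSup_le fun F => iSup_le fun hF => iSup_le fun hFG => ?_
    obtain ⟨𝒜, -, hatoms, rfl⟩ := hatomic F hF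
    exact semivar_mono p q hF hmeas <| sUnion_subset_sUnion fun A hA =>
      ⟨hatoms A hA, (subset_sUnion_of_mem hA).trans hFG⟩
  · exact le_iSup_of_le _ <| le_iSup_of_le hmeas <|
      le_iSup_of_le (sUnion_subset fun _ hA => hA.2) le_rfl
end
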